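/- arXiv:1505.01180 — 3 statements merged into one kernel-verified Lean document; each statement's English description precedes it below -/
import Mathlib

section
/- Let f : ℝⁿ → ℝⁿ be a continuous vector field and V : ℝⁿ → ℝ be continuously differentiable, and define the Lie derivative V̇(x) := ⟨∇V(x), f(x)⟩; assume V̇ is itself continuously differentiable and define V̈(x) := ⟨∇V̇(x), f(x)⟩. Let K ⊆ ℝⁿ and ε₁ > 0 satisfy V̈(y) ≤ ε₁ for all y ∈ K. Let ε_Q > 0 and λ > 1, and set δ := (λ − 1)·ε_Q/(λ·ε₁). Suppose x : ℝ → ℝⁿ satisfies x′(t) = f(x(t)) and x(t) ∈ K for all t ∈ [T, T + δ], and suppose V̇(x(T)) < −ε_Q. Then V̇(x(t)) ≤ −ε_Q/λ for all t ∈ [T, T + δ]. (In particular δ is a valid minimum dwell time for the mode with dynamics f.) -/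
open scoped RealInnerProductSpace

/-- Theorem 1 of the paper: minimum dwell time. If the second Lie
derivative `V̈` is bounded above by `ε₁` on `K`, the trajectory stays in `K` on
`[T, T+δ]` with `δ = (λ-1)·ε_Q/(λ·ε₁)`, and `V̇(x(T)) < -ε_Q`, then
`V̇(x(t)) ≤ -ε_Q/λ` on `[T, T+δ]`. -/
theorem stmt1 {n : ℕ}
    (f : EuclideanSpace ℝ (Fin n) → EuclideanSpace ℝ (Fin n)) (hf : Continuous f)
    (V : EuclideanSpace ℝ (Fin n) → ℝ) (hV : ContDiff ℝ 1 V)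
    (Vdot Vddot : EuclideanSpace ℝ (Fin n) → ℝ)
    (hVdot : ∀ y, Vdot y = ⟪gradient V y, f y⟫)
    (hVdotC1 : ContDiff ℝ 1 Vdot)
    (hVddot : ∀ y, Vddot y = ⟪gradient Vdot y, f y⟫)
    (K : Set (EuclideanSpace ℝ (Fin n))) (ε₁ : ℝ) (hε₁ : 0 < ε₁)
    (hK : ∀ y ∈ K, Vddot y ≤ ε₁)
    (εQ lam : ℝ) (hεQ : 0 < εQ) (hlam : 1 < lam)
    (δ : ℝ) (hδ : δ = (lam - 1) * εQ / (lam * ε₁))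
    (T : ℝ) (x : ℝ → EuclideanSpace ℝ (Fin n))
    (hode : ∀ t ∈ Set.Icc T (T + δ), HasDerivAt x (f (x t)) t)
    (hxK : ∀ t ∈ Set.Icc T (T + δ), x t ∈ K)
    (hinit : Vdot (x T) < -εQ) :
    ∀ t ∈ Set.Icc T (T + δ), Vdot (x t) ≤ -εQ / lam := by
  intro t ht
  have hderiv : ∀ s ∈ Set.Icc T (T + δ), HasDerivAt (fun s => Vdot (x s)) (Vddot (x s)) s := by
    intro s hs
    rw [hVddot, gradient, InnerProductSpace.toDual_symm_apply]
    exact (hVdotC1.differentiable one_ne_zero (x s)).hasFDerivAt.comp_hasDerivAt s (hode s hs)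
  have hgrowth : Vdot (x t) - Vdot (x T) ≤ ε₁ * (t - T) := by
    refine (convex_Icc T (T + δ)).image_sub_le_mul_sub_of_deriv_le (f := fun s => Vdot (x s))
      (fun s hs => (hderiv s hs).continuousAt.continuousWithinAt)
      (fun s hs => (hderiv s (interior_subset hs)).differentiableAt.differentiableWithinAt)
      (fun s hs => ?_) T ⟨le_rfl, ht.1.trans ht.2⟩ t ht ht.1
    have hs' := interior_subset hs
    rw [(hderiv s hs').deriv]
    exact hK _ (hxK s hs')
  have hlam0 : 0 < lam := one_pos.trans hlam
  have hδε : ε₁ * δ = εQ - εQ / lam := by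
    rw [hδ]
    field_simp
  have hmul : ε₁ * (t - T) ≤ ε₁ * δ :=
    mul_le_mul_of_nonneg_left (by linarith [ht.2]) hε₁.le
  rw [neg_div]
  linarith
end

section
/- For compact sets S, G ⊆ ℝⁿ, a continuous function V : ℝⁿ → ℝ, and β ∈ ℝ, define the region W := {x ∈ S : V(x) ≤ β}. Assume V(y) > β for every y ∈ ∂S \ G, and let ε > 0. Let x : ℝ → ℝⁿ be continuous on [0, ∞) with x(0) ∈ W, and suppose that for every t ≥ 0 with x(t) ∈ W \ G, the function v := V ∘ x has a right derivative at t (a derivative within [t, ∞)) that is at most −ε. Then there exists T ≥ 0 such that x(T) ∈ G and x(t) ∈ W for all t ∈ [0, T]. -/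
open Set Filter Topology in
/-- A function with negative right derivative lies strictly below its value just to the right. -/
theorem HasDerivWithinAt.eventually_lt_of_neg {f : ℝ → ℝ} {d t : ℝ}
    (h : HasDerivWithinAt f d (Ici t) t) (hd : d < 0) : ∀ᶠ s in 𝓝[>] t, f s < f t := by
  have hslope := (hasDerivWithinAt_iff_tendsto_slope' self_notMem_Ioi).1 h.Ioi_of_Ici
  filter_upwards [hslope.eventually (gt_mem_nhds hd), self_mem_nhdsWithin] with s hs hts
  rw [slope_def_field, div_neg_iff] at hs
  have : t < s := hts
  rcases hs with hs | hs <;> linarith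

open Set Filter Topology in
/-- A trajectory in a compact sublevel region stays there as long as `V` decreases strictly along
it and `V` exceeds the level on the part of the boundary that it can reach. -/
theorem mem_sublevel_of_right_deriv_neg {E : Type*} [TopologicalSpace E] {S G : Set E}
    (hS : IsClosed S) {V : E → ℝ} (hV : Continuous V) {β : ℝ}
    (hbd : ∀ y ∈ frontier S \ G, β < V y) {x : ℝ → E} {a b : ℝ}
    (hx : ContinuousOn x (Icc a b)) (hxa : x a ∈ {y ∈ S | V y ≤ β})
    (hxG : ∀ t ∈ Ico a b, x t ∉ G)
    (hdec : ∀ t ∈ Ico a b, x t ∈ {y ∈ S | V y ≤ β} →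
      ∃ d, HasDerivWithinAt (fun s => V (x s)) d (Ici t) t ∧ d < 0) :
    ∀ t ∈ Icc a b, x t ∈ {y ∈ S | V y ≤ β} := by
  have hclosed : IsClosed ({t | x t ∈ {y ∈ S | V y ≤ β}} ∩ Icc a b) := by
    rw [inter_comm]
    exact hx.preimage_isClosed_of_isClosed isClosed_Icc
      (hS.inter (isClosed_le hV continuous_const))
  refine hclosed.Icc_subset_of_forall_mem_nhdsWithin hxa fun t ⟨ht, hab⟩ => ?_
  obtain ⟨d, hd, hd0⟩ := hdec t hab ht
  have hint : x t ∈ interior S := by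
    by_contra hni
    exact (hbd _ ⟨⟨subset_closure ht.1, hni⟩, hxG t hab⟩).not_ge ht.2
  have hcont : Tendsto x (𝓝[>] t) (𝓝 (x t)) :=
    (hx t (Ico_subset_Icc_self hab)).mono_left
      (nhdsWithin_le_of_mem (mem_of_superset (Ioo_mem_nhdsGT hab.2)
        fun s hs => ⟨hab.1.trans hs.1.le, hs.2.le⟩))
  filter_upwards [hcont (isOpen_interior.mem_nhds hint), hd.eventually_lt_of_neg hd0]
    with s hs hVs
  exact ⟨interior_subset hs, hVs.le.trans ht.2⟩

open Set in
/-- A function whose right derivative is at most `-ε` decreases at least at rate `ε`. -/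
theorem le_sub_mul_of_right_deriv_le {f : ℝ → ℝ} {a b ε : ℝ} (hf : ContinuousOn f (Icc a b))
    (hd : ∀ t ∈ Ico a b, ∃ d, HasDerivWithinAt f d (Ici t) t ∧ d ≤ -ε) :
    ∀ t ∈ Icc a b, f t ≤ f a - ε * (t - a) := by
  choose! f' hf' hle using hd
  have hB (t : ℝ) : HasDerivAt (fun s => f a - ε * (s - a)) (-ε) t := by
    simpa using (((hasDerivAt_id t).sub_const a).const_mul ε).const_sub (f a)
  exact fun t ht => image_le_of_deriv_right_le_deriv_boundary hf hf' (by simp)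
    (fun s _ => (hB s).continuousAt.continuousWithinAt)
    (fun s _ => (hB s).hasDerivWithinAt) hle ht


/-- core of Theorem 2: a trajectory starting in
`W = {x ∈ S | V x ≤ β}`, along which `V` decreases at rate at least `ε`
whenever the state is in `W \ G`, stays in `W` until it reaches `G`, and it
does reach `G`. -/
theorem stmt8 {n : ℕ} (S G : Set (EuclideanSpace ℝ (Fin n)))
    (hS : IsCompact S) (hG : IsCompact G)
    (V : EuclideanSpace ℝ (Fin n) → ℝ) (hV : Continuous V) (β : ℝ)
    (W : Set (EuclideanSpace ℝ (Fin n))) (hW : W = {x ∈ S | V x ≤ β})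
    (hbd : ∀ y ∈ frontier S \ G, V y > β)
    (ε : ℝ) (hε : 0 < ε)
    (x : ℝ → EuclideanSpace ℝ (Fin n)) (hx : ContinuousOn x (Set.Ici 0))
    (hx0 : x 0 ∈ W)
    (hdec : ∀ t : ℝ, 0 ≤ t → x t ∈ W \ G →
      ∃ d, HasDerivWithinAt (fun s => V (x s)) d (Set.Ici t) t ∧ d ≤ -ε) :
    ∃ T : ℝ, 0 ≤ T ∧ x T ∈ G ∧ ∀ t ∈ Set.Icc 0 T, x t ∈ W := by
  subst hW
  have hstay (T : ℝ) (hT : ∀ t ∈ Set.Ico 0 T, x t ∉ G) :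
      ∀ t ∈ Set.Icc 0 T, x t ∈ {x ∈ S | V x ≤ β} :=
    mem_sublevel_of_right_deriv_neg hS.isClosed hV hbd (hx.mono Set.Icc_subset_Ici_self) hx0 hT
      fun t ht hW => by
        obtain ⟨d, hd, hle⟩ := hdec t ht.1 ⟨hW, hT t ht⟩
        exact ⟨d, hd, by linarith⟩
  have hreach : (Set.Ici 0 ∩ x ⁻¹' G).Nonempty := by
    by_contra! hempty
    have hG' (t : ℝ) (ht : 0 ≤ t) : x t ∉ G := fun h => hempty.le ⟨ht, h⟩
    obtain ⟨m, hm⟩ := hS.bddBelow_image hV.continuousOn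
    have hmV (t : ℝ) (ht : 0 ≤ t) : m ≤ V (x t) :=
      hm ⟨x t, (hstay t (fun s hs => hG' s hs.1) t ⟨ht, le_rfl⟩).1, rfl⟩
    have hm0 := hmV 0 le_rfl
    set T := (V (x 0) - m + 1) / ε
    have hT : 0 ≤ T := div_nonneg (by linarith) hε.le
    have hdrop := le_sub_mul_of_right_deriv_le (f := fun s => V (x s)) (a := 0) (b := T) (ε := ε)
      (hV.comp_continuousOn (hx.mono Set.Icc_subset_Ici_self))
      (fun t ht => hdec t ht.1 ⟨hstay t (fun s hs => hG' s hs.1) t ⟨ht.1, le_rfl⟩, hG' t ht.1⟩)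
      T ⟨hT, le_rfl⟩
    have hεT : ε * T = V (x 0) - m + 1 := mul_div_cancel₀ _ hε.ne'
    have hmT := hmV T hT
    simp only [sub_zero] at hdrop
    linarith
  have hclosed : IsClosed (Set.Ici 0 ∩ x ⁻¹' G) :=
    hx.preimage_isClosed_of_isClosed isClosed_Ici hG.isClosed
  have hbelow : BddBelow (Set.Ici 0 ∩ x ⁻¹' G) := ⟨0, fun t ht => ht.1⟩
  have hmem := hclosed.csInf_mem hreach hbelow
  exact ⟨_, hmem.1, hmem.2, hstay _ fun t ht hGt => (csInf_le hbelow ⟨ht.1, hGt⟩).not_gt ht.2⟩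
end

section
/- Let K be a finite index set; for each k ∈ K let G_k : ℝⁿ → ℝ be continuous and L_k : ℝⁿ → (ℝᵐ →L[ℝ] ℝ) be a continuous map into continuous linear functionals, and define F_k(x, c) := G_k(x) + L_k(x)(c) (a function polynomially/continuously depending on x and affine in c). Let R ⊆ ℝⁿ be compact and let ε_T > 0. Then there exists η > 0 such that: for every c₀ ∈ ℝᵐ and every x₀ ∈ R satisfying F_k(x₀, c₀) ≥ 0 for all k ∈ K, and for every c ∈ ℝᵐ with ‖c − c₀‖ ≤ η, one has F_k(x₀, c) ≥ −ε_T for all k ∈ K. In particular, no point of the η-ball around c₀ satisfies the strengthened refinement constraint ∃k, F_k(x₀, c) < −ε_T. -/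
/-- Theorem 3: with constraints `F k x c = G k x + L k x c`
affine in the candidate `c` and `x` ranging over a compact region `R`, there is
a uniform `η > 0` such that whenever a witness `x₀ ∈ R` refutes a candidate
`c₀` (i.e. `F k x₀ c₀ ≥ 0` for all `k`), every `c` in the `η`-ball around `c₀`
satisfies `F k x₀ c ≥ -ε_T` for all `k`; in particular no such `c` satisfies
the strengthened refinement constraint `∃ k, F k x₀ c < -ε_T`. -/
theorem stmt10 {n m : ℕ} (K : Type*) [Fintype K]
    (G : K → EuclideanSpace ℝ (Fin n) → ℝ) (hG : ∀ k, Continuous (G k))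
    (L : K → EuclideanSpace ℝ (Fin n) → (EuclideanSpace ℝ (Fin m) →L[ℝ] ℝ))
    (hL : ∀ k, Continuous (L k))
    (F : K → EuclideanSpace ℝ (Fin n) → EuclideanSpace ℝ (Fin m) → ℝ)
    (hF : ∀ k x c, F k x c = G k x + L k x c)
    (R : Set (EuclideanSpace ℝ (Fin n))) (hR : IsCompact R)
    (εT : ℝ) (hεT : 0 < εT) :
    ∃ η : ℝ, 0 < η ∧
      ∀ (c₀ : EuclideanSpace ℝ (Fin m)) (x₀ : EuclideanSpace ℝ (Fin n)),
        x₀ ∈ R → (∀ k, F k x₀ c₀ ≥ 0) →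
        ∀ c : EuclideanSpace ℝ (Fin m), ‖c - c₀‖ ≤ η →
          (∀ k, F k x₀ c ≥ -εT) ∧ ¬ (∃ k, F k x₀ c < -εT) := by
  obtain ⟨C, hC⟩ := hR.exists_bound_of_continuousOn
    (f := fun x => ∑ k, ‖L k x‖) (by fun_prop)
  have hpos : 0 < |C| + 1 := by positivity
  refine ⟨εT / (|C| + 1), by positivity, fun c₀ x₀ hx₀ h₀ c hc => ?_⟩
  have key : ∀ k, F k x₀ c ≥ -εT := fun k => by
    have hL_le : ‖L k x₀‖ ≤ |C| + 1 := calc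
      ‖L k x₀‖ ≤ ∑ j, ‖L j x₀‖ :=
        Finset.single_le_sum (f := fun j => ‖L j x₀‖) (fun _ _ => norm_nonneg _)
          (Finset.mem_univ k)
      _ ≤ C := (le_abs_self _).trans (hC x₀ hx₀)
      _ ≤ |C| + 1 := by linarith [le_abs_self C]
    have hdiff : |L k x₀ (c - c₀)| ≤ εT := calc
      |L k x₀ (c - c₀)| ≤ ‖L k x₀‖ * ‖c - c₀‖ := (L k x₀).le_opNorm _
      _ ≤ (|C| + 1) * (εT / (|C| + 1)) := by gcongr
      _ = εT := by field_simp
    have h := h₀ k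
    rw [hF] at h ⊢
    rw [map_sub] at hdiff
    linarith [(abs_le.mp hdiff).1]
  exact ⟨key, fun ⟨k, hk⟩ => absurd hk (key k).not_gt⟩
end
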